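/- arXiv:math/0701449 — 4 statements merged into one kernel-verified Lean document; each statement's English description precedes it below -/
import Mathlib

section
/- Geometric properties of the pre-post-collisional change of variables: fix N ≥ 2, α ∈ (0,1], σ ∈ S^{N−1} and v_* ∈ ℝ^N, and define φ_α : ℝ^N → ℝ^N by φ_α(v) = (v+v_*)/2 + ((1−α)/4)(v−v_*) + ((1+α)/4)|v−v_*| σ. For δ ∈ (0,2) let Ω_δ = {u ∈ ℝ^N, u ≠ 0 : (u/|u|)·σ > δ−1}, set r_α = (1+α)/(3−α) and ω_α(δ) = 1 + (δ−1+r_α)/(1 + 2(δ−1)r_α + r_α²)^{1/2}. Then φ_α restricted to v_* + Ω_δ is a C^∞ diffeomorphism onto v_* + Ω_{ω_α(δ)}, and there exists a constant C ∈ (0,∞) depending only on N such that, with C_δ = C/δ, for all v ∈ v_* + Ω_δ: C_δ^{−1}|v − v_*| ≤ |φ_α(v) − v_*| ≤ 2|v − v_*|, and the Jacobian J_α = det(Dφ_α) satisfies |J_α(v)| ≤ C_δ and |J_α(v)|^{−1} ≤ C_δ, uniformly with respect to α ∈ (0,1], σ ∈ S^{N−1} and v_* ∈ ℝ^N. -/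
open MeasureTheory Real Filter Set
open scoped InnerProductSpace ENNReal

noncomputable section

/-- `ℝ^N` as a Euclidean space. -/
abbrev V (N : ℕ) := EuclideanSpace ℝ (Fin N)

/-- The unit sphere `S^{N-1}` in `ℝ^N`. -/
abbrev Sph (N : ℕ) := Metric.sphere (0 : V N) 1

/-- Surface measure on the unit sphere. -/
def sphμ (N : ℕ) : Measure (Sph N) := (volume : Measure (V N)).toSphere

/-- Hypotheses on the collision cross-section `b`: Lipschitz, non-decreasing and convex
on `(-1,1)`, and bounded from above and below by positive constants on `[-1,1]`. -/
structure CrossSection (b : ℝ → ℝ) : Prop where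
  lip : ∃ L : NNReal, LipschitzOnWith L b (Set.Icc (-1) 1)
  mono : MonotoneOn b (Set.Ioo (-1) 1)
  conv : ConvexOn ℝ (Set.Ioo (-1) 1) b
  bdd : ∃ bm bM : ℝ, 0 < bm ∧ bm ≤ bM ∧ ∀ x ∈ Set.Icc (-1:ℝ) 1, bm ≤ b x ∧ b x ≤ bM

/-- Post-collisional velocity `v' = (v+v_*)/2 + u'/2`,
`u' = ((1-α)/2) u + ((1+α)/2)|u|σ`, `u = v - v_*`. -/
def postV {N : ℕ} (α : ℝ) (v vs : V N) (σ : Sph N) : V N :=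
  (2:ℝ)⁻¹ • (v + vs) + ((1 - α)/4) • (v - vs) + (((1 + α)/4) * ‖v - vs‖) • (σ : V N)

/-- Post-collisional velocity `v'_* = (v+v_*)/2 - u'/2`. -/
def postVs {N : ℕ} (α : ℝ) (v vs : V N) (σ : Sph N) : V N :=
  (2:ℝ)⁻¹ • (v + vs) - ((1 - α)/4) • (v - vs) - (((1 + α)/4) * ‖v - vs‖) • (σ : V N)

/-- The argument `û·σ` of the cross-section, `u = v - v_*`. -/
def bArg {N : ℕ} (v vs : V N) (σ : Sph N) : ℝ := ⟪‖v - vs‖⁻¹ • (v - vs), (σ : V N)⟫_ℝ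

/-- Weighted `L¹` norm `‖f‖_{L¹_q} = ∫ |f(v)| ⟨v⟩^q dv`, `⟨v⟩ = (1+|v|²)^{1/2}`. -/
def wnorm {N : ℕ} (q : ℝ) (f : V N → ℝ) : ℝ :=
  ∫ v : V N, |f v| * (1 + ‖v‖ ^ 2) ^ (q / 2)

/-- Membership in the weighted space `L¹_q`. -/
def MemL1 {N : ℕ} (q : ℝ) (f : V N → ℝ) : Prop :=
  Integrable (fun v : V N => f v * (1 + ‖v‖ ^ 2) ^ (q / 2))

/-- The weak-form collision integral `∫ Q_α(g,f) ψ dv`. -/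
def collInt {N : ℕ} (b : ℝ → ℝ) (α : ℝ) (g f ψ : V N → ℝ) : ℝ :=
  ∫ v : V N, ∫ vs : V N, ∫ σ, b (bArg v vs σ) * ‖v - vs‖ * g vs * f v *
      (ψ (postV α v vs σ) - ψ v) ∂(sphμ N)

/-- `G` is a self-similar profile: nonnegative, in `L¹₂`, of mass `ρ` and vanishing momentum,
satisfying `Q_α(G,G) - τ ∇_v·(v G) = 0` in the weak sense. -/
def IsProfile {N : ℕ} (b : ℝ → ℝ) (α ρ τ : ℝ) (G : V N → ℝ) : Prop :=
  (∀ v, 0 ≤ G v) ∧ MemL1 2 G ∧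
  (∫ v : V N, G v) = ρ ∧ (∫ v : V N, G v • v) = 0 ∧
  ∀ ψ : V N → ℝ, ContDiff ℝ (⊤ : ℕ∞) ψ → HasCompactSupport ψ →
    collInt b α G G ψ + τ * (∫ v : V N, fderiv ℝ ψ v v * G v) = 0

/-- The cone `Ω_δ = {u ≠ 0 : û·σ > δ - 1}`. -/
def Omega {N : ℕ} (δ : ℝ) (σ : Sph N) : Set (V N) :=
  {u | u ≠ 0 ∧ δ - 1 < ⟪‖u‖⁻¹ • u, (σ : V N)⟫_ℝ}

/-- `r_α = (1+α)/(3-α)`. -/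
def rA (α : ℝ) : ℝ := (1 + α) / (3 - α)

/-- `ω_α(δ) = 1 + (δ-1+r_α)/(1+2(δ-1)r_α+r_α²)^{1/2}`. -/
def omegaA (α δ : ℝ) : ℝ :=
  1 + (δ - 1 + rA α) / Real.sqrt (1 + 2 * (δ - 1) * rA α + rA α ^ 2)

section Scattering

variable {E : Type*} [NormedAddCommGroup E] [InnerProductSpace ℝ E]

/-- The map `u ↦ a u + b |u| σ`. -/
def scatter (a b : ℝ) (σ u : E) : E := a • u + (b * ‖u‖) • σ

/-- The discriminant of the quadratic equation satisfied by the norm of a preimage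
under `scatter`. -/
def scatterDiscr (a b : ℝ) (σ w : E) : ℝ :=
  b ^ 2 * ⟪w, σ⟫_ℝ ^ 2 + (a ^ 2 - b ^ 2) * ‖w‖ ^ 2

/-- The norm of the preimage of `w` under `scatter`. -/
def scatterRadius (a b : ℝ) (σ w : E) : ℝ :=
  ‖w‖ ^ 2 / (b * ⟪w, σ⟫_ℝ + √(scatterDiscr a b σ w))

/-- The inverse of `scatter`. -/
def scatterInv (a b : ℝ) (σ w : E) : E := a⁻¹ • (w - (b * scatterRadius a b σ w) • σ)

lemma norm_smul_add_smul_sq (a b : ℝ) {σ : E} (hσ : ‖σ‖ = 1) (u : E) :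
    ‖a • u + b • σ‖ ^ 2 = a ^ 2 * ‖u‖ ^ 2 + 2 * a * b * ⟪u, σ⟫_ℝ + b ^ 2 := by
  rw [norm_add_sq_real, norm_smul, norm_smul, inner_smul_left, inner_smul_right, hσ,
    Real.norm_eq_abs, Real.norm_eq_abs, mul_pow, mul_pow, sq_abs, sq_abs]
  simp
  ring

lemma norm_scatter_sq (a b : ℝ) {σ : E} (hσ : ‖σ‖ = 1) (u : E) :
    ‖scatter a b σ u‖ ^ 2 =
      (a ^ 2 + b ^ 2) * ‖u‖ ^ 2 + 2 * a * b * ‖u‖ * ⟪u, σ⟫_ℝ := by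
  rw [scatter, norm_smul_add_smul_sq _ _ hσ]
  ring

lemma inner_scatter (a b : ℝ) {σ : E} (hσ : ‖σ‖ = 1) (u : E) :
    ⟪scatter a b σ u, σ⟫_ℝ = a * ⟪u, σ⟫_ℝ + b * ‖u‖ := by
  rw [scatter, inner_add_left, inner_smul_left, inner_smul_left, real_inner_self_eq_norm_sq, hσ]
  simp

lemma norm_scatter_le {a b : ℝ} (ha : 0 ≤ a) (hb : 0 ≤ b) {σ : E} (hσ : ‖σ‖ = 1) (u : E) :
    ‖scatter a b σ u‖ ≤ (a + b) * ‖u‖ := by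
  refine (norm_add_le _ _).trans_eq ?_
  rw [norm_smul, norm_smul, hσ, Real.norm_of_nonneg ha,
    Real.norm_of_nonneg (mul_nonneg hb (norm_nonneg u))]
  ring

lemma abs_inner_le_norm_of_unit {σ : E} (hσ : ‖σ‖ = 1) (u : E) : |⟪u, σ⟫_ℝ| ≤ ‖u‖ := by
  simpa [hσ] using abs_real_inner_le_norm u σ

lemma scatterRadius_scatter {a b : ℝ} {σ : E} (hσ : ‖σ‖ = 1) {u : E}
    (hpos : 0 ≤ a * (a * ‖u‖ + b * ⟪u, σ⟫_ℝ)) (h0 : scatter a b σ u ≠ 0) :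
    scatterRadius a b σ (scatter a b σ u) = ‖u‖ := by
  have hE : √(scatterDiscr a b σ (scatter a b σ u)) = a * (a * ‖u‖ + b * ⟪u, σ⟫_ℝ) := by
    rw [← Real.sqrt_sq hpos, scatterDiscr, inner_scatter a b hσ, norm_scatter_sq a b hσ]
    congr 1
    ring
  have hw : ‖scatter a b σ u‖ ^ 2 ≠ 0 := by simpa using h0
  rw [norm_scatter_sq a b hσ] at hw
  rw [scatterRadius, hE, inner_scatter a b hσ, norm_scatter_sq a b hσ, div_eq_iff]
  · ring
  · intro h
    apply hw
    linear_combination ‖u‖ * h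

lemma scatterInv_scatter {a b : ℝ} (ha : a ≠ 0) {σ : E} (hσ : ‖σ‖ = 1) {u : E}
    (hpos : 0 ≤ a * (a * ‖u‖ + b * ⟪u, σ⟫_ℝ)) (h0 : scatter a b σ u ≠ 0) :
    scatterInv a b σ (scatter a b σ u) = u := by
  rw [scatterInv, scatterRadius_scatter hσ hpos h0, scatter, add_sub_cancel_right,
    inv_smul_smul₀ ha]

lemma scatterDiscr_pos {a b : ℝ} (hb : 0 < b) (hab : b ≤ a) {σ w : E} (hw : w ≠ 0)
    (h : b < a ∨ 0 < ⟪w, σ⟫_ℝ) : 0 < scatterDiscr a b σ w := by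
  have hn : 0 < ‖w‖ ^ 2 := by positivity
  rw [scatterDiscr]
  rcases h with h | h
  · have : 0 < a ^ 2 - b ^ 2 := by nlinarith
    positivity
  · have : 0 ≤ a ^ 2 - b ^ 2 := by nlinarith
    positivity

lemma scatterRadius_denom_pos {a b : ℝ} (hb : 0 < b) (hab : b ≤ a) {σ w : E} (hw : w ≠ 0)
    (h : b < a ∨ 0 < ⟪w, σ⟫_ℝ) : 0 < b * ⟪w, σ⟫_ℝ + √(scatterDiscr a b σ w) := by
  rcases h with h | h
  · have hn : 0 < ‖w‖ ^ 2 := by positivity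
    have h1 : 0 < a ^ 2 - b ^ 2 := by nlinarith
    have : |b * ⟪w, σ⟫_ℝ| < √(scatterDiscr a b σ w) := by
      apply Real.lt_sqrt_of_sq_lt
      rw [sq_abs, scatterDiscr]
      nlinarith [mul_pos h1 hn]
    linarith [neg_abs_le (b * ⟪w, σ⟫_ℝ)]
  · positivity

lemma norm_scatterInv {a b : ℝ} (hb : 0 < b) (hab : b ≤ a) {σ w : E} (hσ : ‖σ‖ = 1) (hw : w ≠ 0)
    (h : b < a ∨ 0 < ⟪w, σ⟫_ℝ) : ‖scatterInv a b σ w‖ = scatterRadius a b σ w := by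
  have ha : 0 < a := hb.trans_le hab
  have hD := scatterRadius_denom_pos hb hab hw h
  have hE := Real.sq_sqrt (scatterDiscr_pos hb hab hw h).le
  have hR : 0 ≤ scatterRadius a b σ w := div_nonneg (sq_nonneg _) hD.le
  have hRD : scatterRadius a b σ w * (b * ⟪w, σ⟫_ℝ + √(scatterDiscr a b σ w)) = ‖w‖ ^ 2 :=
    div_mul_cancel₀ _ hD.ne'
  have hquad : ‖w‖ ^ 2 - 2 * (b * scatterRadius a b σ w) * ⟪w, σ⟫_ℝ
      + (b * scatterRadius a b σ w) ^ 2 = a ^ 2 * scatterRadius a b σ w ^ 2 := by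
    rw [scatterDiscr] at hE
    rw [scatterDiscr] at hRD hD
    set e := √(b ^ 2 * ⟪w, σ⟫_ℝ ^ 2 + (a ^ 2 - b ^ 2) * ‖w‖ ^ 2)
    set R := scatterRadius a b σ w
    have hR' : (a ^ 2 - b ^ 2) * R = e - b * ⟪w, σ⟫_ℝ := by
      apply mul_right_cancel₀ hD.ne'
      linear_combination (a ^ 2 - b ^ 2) * hRD - hE
    linear_combination -hRD - R * hR'
  have hnorm : ‖w - (b * scatterRadius a b σ w) • σ‖ = a * scatterRadius a b σ w := by
    rw [← sq_eq_sq₀ (norm_nonneg _) (by positivity), mul_pow, ← hquad]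
    have := norm_smul_add_smul_sq 1 (-(b * scatterRadius a b σ w)) hσ w
    rw [one_smul, neg_smul, ← sub_eq_add_neg] at this
    rw [this]
    ring
  rw [scatterInv, norm_smul, hnorm, norm_inv, Real.norm_of_nonneg ha.le, inv_mul_cancel_left₀ ha.ne']

lemma scatter_scatterInv {a b : ℝ} (hb : 0 < b) (hab : b ≤ a) {σ w : E} (hσ : ‖σ‖ = 1)
    (hw : w ≠ 0) (h : b < a ∨ 0 < ⟪w, σ⟫_ℝ) : scatter a b σ (scatterInv a b σ w) = w := by
  rw [scatter, norm_scatterInv hb hab hσ hw h, scatterInv, smul_inv_smul₀ (hb.trans_le hab).ne',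
    sub_add_cancel]

lemma contDiffOn_scatter (a b : ℝ) (σ : E) {n : WithTop ℕ∞} {s : Set E} (hs : ∀ u ∈ s, u ≠ 0) :
    ContDiffOn ℝ n (scatter a b σ) s := by
  have h : ContDiffOn ℝ n (fun u : E => ‖u‖) s := contDiffOn_id.norm ℝ hs
  exact (contDiffOn_id.const_smul a).add ((contDiffOn_const.mul h).smul contDiffOn_const)

lemma contDiffOn_scatterInv {a b : ℝ} (hb : 0 < b) (hab : b ≤ a) {σ : E} {n : WithTop ℕ∞}
    {s : Set E} (hs : ∀ w ∈ s, w ≠ 0) (h : ∀ w ∈ s, b < a ∨ 0 < ⟪w, σ⟫_ℝ) :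
    ContDiffOn ℝ n (scatterInv a b σ) s := by
  have hin : ContDiff ℝ n (fun w : E => ⟪w, σ⟫_ℝ) := contDiff_id.inner ℝ contDiff_const
  have hsq : ContDiff ℝ n (fun w : E => ‖w‖ ^ 2) := contDiff_norm_sq ℝ
  have hdis : ContDiff ℝ n (fun w : E => scatterDiscr a b σ w) :=
    (contDiff_const.mul (hin.pow 2)).add (contDiff_const.mul hsq)
  have hrad : ContDiffOn ℝ n (fun w : E => scatterRadius a b σ w) s :=
    hsq.contDiffOn.div ((contDiff_const.mul hin).contDiffOn.add
      (hdis.contDiffOn.sqrt fun w hw => (scatterDiscr_pos hb hab (hs w hw) (h w hw)).ne'))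
      fun w hw => (scatterRadius_denom_pos hb hab (hs w hw) (h w hw)).ne'
  exact (contDiffOn_id.sub ((contDiffOn_const.mul hrad).smul contDiffOn_const)).const_smul a⁻¹

lemma hasFDerivAt_norm_of_ne_zero {u : E} (hu : u ≠ 0) :
    HasFDerivAt (fun x : E => ‖x‖) (‖u‖⁻¹ • innerSL ℝ u) u := by
  have h : HasFDerivAt (fun x : E => ‖x‖ ^ 2) (2 • innerSL ℝ u) u :=
    (hasStrictFDerivAt_norm_sq u).hasFDerivAt
  have h2 := h.sqrt (by positivity)
  simp only [Real.sqrt_sq (norm_nonneg _)] at h2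
  convert h2 using 1
  ext x
  simp
  field_simp

lemma hasFDerivAt_scatter (a b : ℝ) (σ : E) {u : E} (hu : u ≠ 0) :
    HasFDerivAt (scatter a b σ)
      (a • ContinuousLinearMap.id ℝ E + ((b * ‖u‖⁻¹) • innerSL ℝ u).smulRight σ) u := by
  have h := ((hasFDerivAt_id u).const_smul a).add
    (((hasFDerivAt_norm_of_ne_zero hu).const_mul b).smul_const σ)
  rw [smul_smul] at h
  exact h

lemma det_smul_id_add_smulRight [FiniteDimensional ℝ E] {a : ℝ} (ha : a ≠ 0)
    (f : E →L[ℝ] ℝ) (x : E) :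
    (a • ContinuousLinearMap.id ℝ E + f.smulRight x).det =
      a ^ Module.finrank ℝ E * (1 + a⁻¹ * f x) := by
  have h : ((a • ContinuousLinearMap.id ℝ E + f.smulRight x : E →L[ℝ] E) : E →ₗ[ℝ] E) =
      a • LinearMap.transvection (f : Module.Dual ℝ E) (a⁻¹ • x) := by
    ext y
    have : a * (f y * a⁻¹) = f y := by field_simp
    simp [LinearMap.transvection, smul_smul, this]
  rw [ContinuousLinearMap.det, h, LinearMap.det_smul, LinearMap.transvection.det]
  simp

lemma det_fderiv_scatter [FiniteDimensional ℝ E] {a : ℝ} (ha : a ≠ 0) (b : ℝ) (σ : E) {u : E}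
    (hu : u ≠ 0) :
    (fderiv ℝ (scatter a b σ) u).det =
      a ^ Module.finrank ℝ E * (1 + a⁻¹ * (b * ⟪‖u‖⁻¹ • u, σ⟫_ℝ)) := by
  rw [(hasFDerivAt_scatter a b σ hu).fderiv, det_smul_id_add_smulRight ha]
  simp [inner_smul_left, mul_assoc]

end Scattering

/-- The cosine of the angle between `σ` and `e + r σ`, for unit vectors `e`, `σ` forming an angle
of cosine `c`. -/
def scatterCos (r c : ℝ) : ℝ := (c + r) / √(1 + 2 * c * r + r ^ 2)

lemma scatterCos_eq {r c : ℝ} (hr : 0 < r) (hc : 0 < 1 + 2 * c * r + r ^ 2) :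
    scatterCos r c =
      (√(1 + 2 * c * r + r ^ 2) - (1 - r ^ 2) / √(1 + 2 * c * r + r ^ 2)) / (2 * r) := by
  have h := Real.sq_sqrt hc.le
  have h0 := Real.sqrt_pos.2 hc
  rw [scatterCos]
  set p := √(1 + 2 * c * r + r ^ 2)
  field_simp
  linear_combination -h

lemma scatterCos_strictMonoOn {r : ℝ} (hr : 0 < r) (hr1 : r ≤ 1) :
    StrictMonoOn (scatterCos r) {c | 0 < 1 + 2 * c * r + r ^ 2} := by
  intro c hc d hd hcd
  simp only [Set.mem_ofPred_eq] at hc hd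
  rw [scatterCos_eq hr hc, scatterCos_eq hr hd]
  have h0 := Real.sqrt_pos.2 hc
  have hlt : √(1 + 2 * c * r + r ^ 2) < √(1 + 2 * d * r + r ^ 2) :=
    Real.sqrt_lt_sqrt hc.le (by nlinarith)
  have h1 : 0 ≤ 1 - r ^ 2 := by nlinarith
  have h2 := div_le_div_of_nonneg_left h1 h0 hlt.le
  exact div_lt_div_of_pos_right (by linarith) (by positivity)

lemma one_add_two_mul_pos {r c : ℝ} (hr : 0 < r) (hc : -1 < c) : 0 < 1 + 2 * c * r + r ^ 2 := by
  nlinarith [sq_nonneg (1 - r)]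

lemma scatterCos_one_pos {c : ℝ} (hc : -1 < c) : 0 < scatterCos 1 c :=
  div_pos (by linarith) (Real.sqrt_pos.2 (one_add_two_mul_pos one_pos hc))

section Cone

variable {E : Type*} [NormedAddCommGroup E] [InnerProductSpace ℝ E]

lemma inner_eq_norm_mul_inner_unit {u : E} (hu : u ≠ 0) (σ : E) :
    ⟪u, σ⟫_ℝ = ‖u‖ * ⟪‖u‖⁻¹ • u, σ⟫_ℝ := by
  rw [inner_smul_left]
  simp [hu]

lemma norm_scatter_sq_eq {a : ℝ} (ha : 0 < a) (b : ℝ) {σ : E} (hσ : ‖σ‖ = 1) {u : E}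
    (hu : u ≠ 0) :
    ‖scatter a b σ u‖ ^ 2 =
      (a * ‖u‖) ^ 2 * (1 + 2 * ⟪‖u‖⁻¹ • u, σ⟫_ℝ * (b / a) + (b / a) ^ 2) := by
  rw [norm_scatter_sq a b hσ, inner_eq_norm_mul_inner_unit hu]
  field_simp
  ring

lemma inner_unit_scatter {a : ℝ} (ha : 0 < a) (b : ℝ) {σ : E} (hσ : ‖σ‖ = 1) {u : E}
    (hu : u ≠ 0) :
    ⟪‖scatter a b σ u‖⁻¹ • scatter a b σ u, σ⟫_ℝ =
      scatterCos (b / a) ⟪‖u‖⁻¹ • u, σ⟫_ℝ := by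
  have hn : 0 < ‖u‖ := norm_pos_iff.2 hu
  have h : ‖scatter a b σ u‖ =
      a * ‖u‖ * √(1 + 2 * ⟪‖u‖⁻¹ • u, σ⟫_ℝ * (b / a) + (b / a) ^ 2) := by
    rw [← Real.sqrt_sq (norm_nonneg (scatter a b σ u)), norm_scatter_sq_eq ha b hσ hu,
      Real.sqrt_mul (sq_nonneg _), Real.sqrt_sq (by positivity)]
  rw [inner_smul_left, h, inner_scatter a b hσ, inner_eq_norm_mul_inner_unit hu, scatterCos]
  set p := √(1 + 2 * ⟪‖u‖⁻¹ • u, σ⟫_ℝ * (b / a) + (b / a) ^ 2)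
  rw [conj_trivial, mul_inv, div_eq_mul_inv, mul_comm _ p⁻¹, mul_assoc, mul_comm _ p⁻¹]
  congr 1
  field_simp

lemma abs_inner_unit_le {σ : E} (hσ : ‖σ‖ = 1) {u : E} (hu : u ≠ 0) :
    |⟪‖u‖⁻¹ • u, σ⟫_ℝ| ≤ 1 := by
  have := abs_real_inner_le_norm (‖u‖⁻¹ • u) σ
  rwa [hσ, norm_smul, norm_inv, norm_norm, inv_mul_cancel₀ (norm_ne_zero_iff.2 hu), mul_one] at this

end Cone

section Omega

variable {N : ℕ} {a b δ : ℝ} {σ : Sph N}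

lemma norm_sph (σ : Sph N) : ‖(σ : V N)‖ = 1 := by simp

lemma scatter_mem_Omega (hb : 0 < b) (hab : b ≤ a) (hδ : 0 < δ) {u : V N}
    (hu : u ∈ Omega δ σ) :
    scatter a b (σ : V N) u ∈ Omega (1 + scatterCos (b / a) (δ - 1)) σ := by
  have ha : 0 < a := hb.trans_le hab
  have hr : 0 < b / a := div_pos hb ha
  obtain ⟨hu0, hc⟩ := hu
  have hn : 0 < ‖u‖ := norm_pos_iff.2 hu0
  have hq := one_add_two_mul_pos hr (show -1 < ⟪‖u‖⁻¹ • u, (σ : V N)⟫_ℝ by linarith)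
  have hne : ‖scatter a b (σ : V N) u‖ ^ 2 ≠ 0 := by
    rw [norm_scatter_sq_eq ha b (norm_sph σ) hu0]
    positivity
  refine ⟨by simpa using hne, ?_⟩
  rw [inner_unit_scatter ha b (norm_sph σ) hu0, add_sub_cancel_left]
  exact scatterCos_strictMonoOn hr ((div_le_one ha).2 hab)
    (one_add_two_mul_pos hr (by linarith)) hq hc

lemma leftInvOn_scatter (hb : 0 < b) (hab : b ≤ a) (hδ : 0 < δ) :
    Set.LeftInvOn (scatterInv a b (σ : V N)) (scatter a b (σ : V N)) (Omega δ σ) := by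
  intro u hu
  have ha : 0 < a := hb.trans_le hab
  refine scatterInv_scatter ha.ne' (norm_sph σ) (mul_nonneg ha.le ?_)
    (scatter_mem_Omega hb hab hδ hu).1
  have := neg_le_of_abs_le (abs_inner_le_norm_of_unit (norm_sph σ) u)
  nlinarith [norm_nonneg u]

lemma lt_or_inner_pos_of_mem_Omega (hb : 0 < b) (hab : b ≤ a) (hδ : 0 < δ) {w : V N}
    (hw : w ∈ Omega (1 + scatterCos (b / a) (δ - 1)) σ) :
    b < a ∨ 0 < ⟪w, (σ : V N)⟫_ℝ := by
  rcases hab.lt_or_eq with h | rfl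
  · exact Or.inl h
  · obtain ⟨hw0, hw1⟩ := hw
    rw [div_self hb.ne', add_sub_cancel_left] at hw1
    have := (scatterCos_one_pos (show -1 < δ - 1 by linarith)).trans hw1
    rw [inner_eq_norm_mul_inner_unit hw0]
    exact Or.inr (mul_pos (norm_pos_iff.2 hw0) this)

lemma rightInvOn_scatter (hb : 0 < b) (hab : b ≤ a) (hδ : 0 < δ) :
    Set.RightInvOn (scatterInv a b (σ : V N)) (scatter a b (σ : V N))
      (Omega (1 + scatterCos (b / a) (δ - 1)) σ) := fun _ hw =>
  scatter_scatterInv hb hab (norm_sph σ) hw.1 (lt_or_inner_pos_of_mem_Omega hb hab hδ hw)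

lemma scatterInv_mem_Omega (hb : 0 < b) (hab : b ≤ a) (hδ : 0 < δ) {w : V N}
    (hw : w ∈ Omega (1 + scatterCos (b / a) (δ - 1)) σ) :
    scatterInv a b (σ : V N) w ∈ Omega δ σ := by
  have ha : 0 < a := hb.trans_le hab
  have hr : 0 < b / a := div_pos hb ha
  have hinv : scatter a b (σ : V N) (scatterInv a b (σ : V N) w) = w :=
    rightInvOn_scatter hb hab hδ hw
  set u := scatterInv a b (σ : V N) w
  have hu0 : u ≠ 0 := by
    intro h
    apply hw.1
    rw [← hinv, h]
    simp [scatter]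
  obtain ⟨hw0, hw1⟩ := hw
  have hq : 0 < 1 + 2 * ⟪‖u‖⁻¹ • u, (σ : V N)⟫_ℝ * (b / a) + (b / a) ^ 2 := by
    have hn : 0 < ‖w‖ ^ 2 := by positivity
    rw [← hinv, norm_scatter_sq_eq ha b (norm_sph σ) hu0] at hn
    exact pos_of_mul_pos_right hn (sq_nonneg _)
  rw [← hinv, inner_unit_scatter ha b (norm_sph σ) hu0, add_sub_cancel_left] at hw1
  exact ⟨hu0, ((scatterCos_strictMonoOn hr ((div_le_one ha).2 hab)).lt_iff_lt
    (one_add_two_mul_pos hr (by linarith)) hq).1 hw1⟩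

end Omega

lemma postV_eq {N : ℕ} (α : ℝ) (v vs : V N) (σ : Sph N) :
    postV α v vs σ = vs + scatter ((3 - α) / 4) ((1 + α) / 4) (σ : V N) (v - vs) := by
  rw [postV, scatter]
  module

lemma omegaA_eq (α δ : ℝ) :
    omegaA α δ = 1 + scatterCos ((1 + α) / 4 / ((3 - α) / 4)) (δ - 1) := by
  have h : (1 + α) / 4 / ((3 - α) / 4) = rA α := div_div_div_cancel_right₀ (by norm_num) _ _
  rw [h]
  rfl

/-- Geometric properties of the pre-post-collisional change of variables
`φ_α : v ↦ v'`: it is a `C^∞` diffeomorphism from `v_* + Ω_δ` onto `v_* + Ω_{ω_α(δ)}`,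
with two-sided distance bounds and two-sided Jacobian bounds `C_δ = C/δ`, uniformly
in `α ∈ (0,1]`, `σ ∈ S^{N-1}` and `v_* ∈ ℝ^N`. -/
theorem collisional_change_of_variables (N : ℕ) (hN : 2 ≤ N) :
    ∃ C : ℝ, 0 < C ∧
      ∀ α ∈ Set.Ioc (0:ℝ) 1, ∀ σ : Sph N, ∀ vs : V N, ∀ δ ∈ Set.Ioo (0:ℝ) 2,
        (Set.BijOn (fun v => postV α v vs σ) {v | v - vs ∈ Omega δ σ}
            {v | v - vs ∈ Omega (omegaA α δ) σ} ∧
          ContDiffOn ℝ (⊤ : ℕ∞) (fun v => postV α v vs σ) {v | v - vs ∈ Omega δ σ} ∧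
          ∃ ψ : V N → V N,
            ContDiffOn ℝ (⊤ : ℕ∞) ψ {v | v - vs ∈ Omega (omegaA α δ) σ} ∧
            Set.InvOn ψ (fun v => postV α v vs σ) {v | v - vs ∈ Omega δ σ}
              {v | v - vs ∈ Omega (omegaA α δ) σ}) ∧
        ∀ v ∈ {w : V N | w - vs ∈ Omega δ σ},
          (C / δ)⁻¹ * ‖v - vs‖ ≤ ‖postV α v vs σ - vs‖ ∧
          ‖postV α v vs σ - vs‖ ≤ 2 * ‖v - vs‖ ∧
          |(fderiv ℝ (fun w => postV α w vs σ) v).det| ≤ C / δ ∧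
          δ / C ≤ |(fderiv ℝ (fun w => postV α w vs σ) v).det| := by
  refine ⟨2 ^ (N + 1), by positivity, ?_⟩
  rintro α ⟨hα0, hα1⟩ σ vs δ ⟨hδ0, hδ2⟩
  rw [omegaA_eq]
  simp only [postV_eq]
  obtain ⟨a, ha⟩ : ∃ a, a = (3 - α) / 4 := ⟨_, rfl⟩
  obtain ⟨b, hb⟩ : ∃ b, b = (1 + α) / 4 := ⟨_, rfl⟩
  rw [← ha, ← hb]
  have hb0 : 0 < b := by linarith
  have hb4 : 1 / 4 ≤ b := by linarith
  have ha2 : 1 / 2 ≤ a := by linarith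
  have hab : b ≤ a := by linarith
  have hab1 : a + b = 1 := by linarith
  have ha0 : 0 < a := by linarith
  have hσ := norm_sph σ
  set g : V N → V N := fun w => vs + scatterInv a b (σ : V N) (w - vs) with hg
  have hinv : Set.InvOn g (fun v => vs + scatter a b (σ : V N) (v - vs)) {v | v - vs ∈ Omega δ σ}
      {v | v - vs ∈ Omega (1 + scatterCos (b / a) (δ - 1)) σ} := by
    constructor
    · intro v hv
      simp [hg, leftInvOn_scatter hb0 hab hδ0 hv]
    · intro w hw
      simp [hg, rightInvOn_scatter hb0 hab hδ0 hw]
  have hsub {n : WithTop ℕ∞} {s : Set (V N)} : ContDiffOn ℝ n (fun v : V N => v - vs) s :=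
    contDiffOn_id.sub contDiffOn_const
  refine ⟨⟨hinv.bijOn ?_ ?_, ?_, g, ?_, hinv⟩, ?_⟩
  · intro v hv
    simpa using scatter_mem_Omega hb0 hab hδ0 hv
  · intro w hw
    simpa [hg] using scatterInv_mem_Omega hb0 hab hδ0 hw
  · exact contDiffOn_const.add
      ((contDiffOn_scatter a b (σ : V N) fun u (hu : u ∈ Omega δ σ) => hu.1).comp hsub
        fun _ hv => hv)
  · exact contDiffOn_const.add
      ((contDiffOn_scatterInv hb0 hab (fun w hw => hw.1)
        fun w hw => lt_or_inner_pos_of_mem_Omega hb0 hab hδ0 hw).comp hsub fun _ hw => hw)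
  · rintro v ⟨hu0, hc⟩
    have hdet : (fderiv ℝ (fun w => vs + scatter a b (σ : V N) (w - vs)) v).det =
        a ^ N * (1 + a⁻¹ * (b * ⟪‖v - vs‖⁻¹ • (v - vs), (σ : V N)⟫_ℝ)) := by
      rw [fderiv_const_add, fderiv_comp_sub, det_fderiv_scatter ha0.ne' b _ hu0,
        finrank_euclideanSpace_fin]
    rw [hdet, add_sub_cancel_left]
    have hnorm := norm_scatter_sq a b hσ (v - vs)
    have hin := inner_eq_norm_mul_inner_unit hu0 (σ : V N)
    have hc1 := (abs_le.1 (abs_inner_unit_le hσ hu0)).2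
    set c := ⟪‖v - vs‖⁻¹ • (v - vs), (σ : V N)⟫_ℝ
    set u := v - vs
    obtain ⟨M, rfl⟩ : ∃ M, N = M + 1 := ⟨N - 1, by omega⟩
    have hJ : a ^ (M + 1) * (1 + a⁻¹ * (b * c)) = a ^ M * (a + b * c) := by
      rw [pow_succ, mul_assoc, mul_add, mul_one, ← mul_assoc a a⁻¹, mul_inv_cancel₀ ha0.ne', one_mul]
    have hlow : δ / 4 ≤ a + b * c := by nlinarith
    have hup : a + b * c ≤ 1 := by nlinarith
    have hpow : (1 / 2 : ℝ) ^ M ≤ a ^ M := pow_le_pow_left₀ (by norm_num) ha2 M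
    have hpow1 : a ^ M ≤ 1 := pow_le_one₀ ha0.le (by linarith)
    have hC : (2 : ℝ) ≤ 2 ^ (M + 1 + 1) := le_self_pow₀ (by norm_num) (by omega)
    have hC4 : (4 : ℝ) ≤ 2 ^ (M + 1 + 1) := by
      have : (1 : ℝ) ≤ 2 ^ M := one_le_pow₀ (by norm_num)
      rw [pow_succ, pow_succ]
      linarith
    rw [hJ, abs_of_nonneg (mul_nonneg (by positivity) (by linarith))]
    refine ⟨?_, ?_, ?_, ?_⟩
    · rw [inv_div]
      have h1 : δ / 2 ^ (M + 1 + 1) ≤ δ / 4 := div_le_div_of_nonneg_left hδ0.le (by norm_num) hC4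
      refine (mul_le_mul_of_nonneg_right h1 (norm_nonneg u)).trans ?_
      apply le_of_sq_le_sq _ (norm_nonneg _)
      have h2 : (δ / 4) ^ 2 ≤ a ^ 2 + b ^ 2 + 2 * a * b * c := by
        have h3 : 1 / 8 ≤ a * b := by nlinarith
        have h4 : 1 / 8 * δ ≤ a * b * (1 + c) := by
          apply mul_le_mul h3 (by linarith) hδ0.le (by linarith)
        nlinarith [sq_nonneg (a - b)]
      rw [hnorm, hin, mul_pow]
      nlinarith [mul_le_mul_of_nonneg_right h2 (sq_nonneg ‖u‖)]
    · refine (norm_scatter_le ha0.le hb0.le hσ u).trans ?_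
      rw [hab1]
      linarith [norm_nonneg u]
    · rw [le_div_iff₀ hδ0]
      have : a ^ M * (a + b * c) ≤ 1 := mul_le_one₀ hpow1 (by linarith) hup
      nlinarith
    · calc δ / 2 ^ (M + 1 + 1) = (1 / 2) ^ M * (δ / 4) := by
            rw [one_div, inv_pow]
            field_simp
            ring
        _ ≤ a ^ M * (a + b * c) := mul_le_mul hpow hlow (by positivity) (by positivity)
end
end

section
/- Two-sided linear-growth bounds for the loss convolution operator: let g ∈ L¹₃(ℝ^N) be nonnegative with mass ρ = ∫ g dv > 0 and zero momentum ∫ g v dv = 0, and define L(g)(v) = b₀ ∫ g(v_*) |v − v_*| dv_* where b₀ = ∫_{S^{N−1}} b(σ·e) dσ for a fixed unit vector e. Then: (i) there exist constants c₁, c₂ ∈ (0,∞) (depending on g) such that c₁(1+|v|) ≤ L(g)(v) ≤ c₂(1+|v|) for all v ∈ ℝ^N; (ii) if moreover ∫ g |v|² dv ≥ a₁ ρ and ∫ g |v|³ dv ≤ a₂ ρ for some constants a₁, a₂ > 0, then one can take c₁ = C^{−1} ρ and c₂ = C ρ for an explicit constant C > 0 depending only on a₁, a₂ and b₀. -/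
open MeasureTheory Real Filter Set
open scoped InnerProductSpace ENNReal

noncomputable section

/-- The constant `b₀ = ∫_{S^{N-1}} b(σ·e) dσ` for a unit vector `e`. -/
def b0 (N : ℕ) (b : ℝ → ℝ) (e : V N) : ℝ := ∫ σ, b ⟪(σ : V N), e⟫_ℝ ∂(sphμ N)

/-- The loss convolution operator `L(g)(v) = b₀ ∫ g(v_*)|v-v_*| dv_*`. -/
def Lconv {N : ℕ} (b : ℝ → ℝ) (e : V N) (g : V N → ℝ) (v : V N) : ℝ :=
  b0 N b e * ∫ vs : V N, g vs * ‖v - vs‖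

/-- Membership in `L¹₃` makes all moments of order at most three finite. -/
lemma MemL1.integrable_mul_norm_pow {N : ℕ} {g : V N → ℝ} (hg : MemL1 3 g) {k : ℕ} (hk : k ≤ 3) :
    Integrable (fun v : V N => g v * ‖v‖ ^ k) := by
  have hw : ∀ v : V N, (0 : ℝ) < 1 + ‖v‖ ^ 2 := fun v => by positivity
  have hc : Continuous (fun v : V N => ‖v‖ ^ k * (1 + ‖v‖ ^ 2) ^ (-(3 / 2) : ℝ)) := by
    refine (continuous_norm.pow k).mul ?_
    exact (by fun_prop : Continuous fun v : V N => 1 + ‖v‖ ^ 2).rpow_const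
      fun v => Or.inl (hw v).ne'
  have hbound : ∀ v : V N, ‖‖v‖ ^ k * (1 + ‖v‖ ^ 2) ^ (-(3 / 2) : ℝ)‖ ≤ 1 := by
    intro v
    have h1 : ‖v‖ ^ k ≤ (1 + ‖v‖ ^ 2) ^ (3 / 2 : ℝ) := by
      have hs : ‖v‖ ≤ √(1 + ‖v‖ ^ 2) := Real.le_sqrt_of_sq_le (by linarith)
      have hs1 : 1 ≤ √(1 + ‖v‖ ^ 2) := Real.one_le_sqrt.2 (by nlinarith [sq_nonneg ‖v‖])
      calc ‖v‖ ^ k ≤ √(1 + ‖v‖ ^ 2) ^ k := by gcongr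
        _ ≤ √(1 + ‖v‖ ^ 2) ^ 3 := pow_le_pow_right₀ hs1 hk
        _ = (1 + ‖v‖ ^ 2) ^ (3 / 2 : ℝ) := by
          rw [Real.sqrt_eq_rpow, ← Real.rpow_natCast, ← Real.rpow_mul (hw v).le]
          norm_num
    rw [Real.norm_of_nonneg (by positivity), Real.rpow_neg (hw v).le, ← div_eq_mul_inv]
    exact div_le_one_of_le₀ h1 (Real.rpow_nonneg (hw v).le _)
  refine (Integrable.bdd_mul (c := 1) hg hc.aestronglyMeasurable
    (Eventually.of_forall hbound)).congr (Eventually.of_forall fun v => ?_)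
  have hpos : (0 : ℝ) < (1 + ‖v‖ ^ 2) ^ (3 / 2 : ℝ) := Real.rpow_pos_of_pos (hw v) _
  simp only
  rw [Real.rpow_neg (hw v).le]
  field_simp

/-- The angular mass `b₀` of a cross-section is positive. -/
lemma CrossSection.b0_pos {N : ℕ} (hN : 2 ≤ N) {b : ℝ → ℝ} (hb : CrossSection b)
    {e : V N} (he : ‖e‖ = 1) : 0 < b0 N b e := by
  obtain ⟨L, hL⟩ := hb.lip
  obtain ⟨bm, bM, hbm, -, hbd⟩ := hb.bdd
  have hmem : ∀ σ : Sph N, ⟪(σ : V N), e⟫_ℝ ∈ Set.Icc (-1 : ℝ) 1 := by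
    intro σ
    have h := abs_real_inner_le_norm (σ : V N) e
    rw [he, norm_eq_of_mem_sphere σ, mul_one] at h
    exact abs_le.1 h
  have hfin : IsFiniteMeasure (sphμ N) := by unfold sphμ; infer_instance
  have hcont : Continuous fun σ : Sph N => b ⟪(σ : V N), e⟫_ℝ :=
    hL.continuousOn.comp_continuous (by fun_prop) hmem
  have hint : Integrable (fun σ : Sph N => b ⟪(σ : V N), e⟫_ℝ) (sphμ N) :=
    (integrable_const bM).mono' hcont.aestronglyMeasurable (Eventually.of_forall fun σ => by
      rw [Real.norm_of_nonneg (hbm.le.trans (hbd _ (hmem σ)).1)]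
      exact (hbd _ (hmem σ)).2)
  have hpos : 0 < (sphμ N).real univ := by
    have hne : sphμ N univ ≠ 0 := by
      rw [sphμ, Measure.toSphere_apply_univ]
      refine mul_ne_zero ?_ (Metric.measure_ball_pos _ _ one_pos).ne'
      simp only [finrank_euclideanSpace, Fintype.card_fin]
      exact_mod_cast (by omega : N ≠ 0)
    exact ENNReal.toReal_pos hne (measure_ne_top _ _)
  calc 0 < (sphμ N).real univ * bm := mul_pos hpos hbm
    _ = ∫ _ : Sph N, bm ∂(sphμ N) := by simp
    _ ≤ b0 N b e := integral_mono (integrable_const _) hint fun σ => (hbd _ (hmem σ)).1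

/-- A nonnegative density of positive mass has positive energy. -/
lemma energy_pos {N : ℕ} (hN : 2 ≤ N) {g : V N → ℝ} (hg0 : ∀ v, 0 ≤ g v) (hg : MemL1 3 g)
    (hmass : 0 < ∫ v : V N, g v) : 0 < ∫ v : V N, g v * ‖v‖ ^ 2 := by
  have : Nonempty (Fin N) := ⟨⟨0, by omega⟩⟩
  have hnn : 0 ≤ fun v : V N => g v * ‖v‖ ^ 2 := fun v => mul_nonneg (hg0 v) (by positivity)
  refine (integral_nonneg hnn).lt_of_ne fun h => hmass.ne' ?_
  have hz := (integral_eq_zero_iff_of_nonneg hnn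
    (hg.integrable_mul_norm_pow (by norm_num : 2 ≤ 3))).1 h.symm
  have hae : ∀ᵐ v : V N, v ≠ 0 := by simp [ae_iff]
  refine integral_eq_zero_of_ae ?_
  filter_upwards [hz, hae] with v hv hv0
  simpa [hv0] using hv

section Moments

variable {N : ℕ} {g : V N → ℝ} {ρ : ℝ}

lemma MemL1.integrable (hg : MemL1 3 g) : Integrable g := by
  simpa using hg.integrable_mul_norm_pow (Nat.zero_le 3)

lemma MemL1.integrable_mul_norm (hg : MemL1 3 g) : Integrable fun w : V N => g w * ‖w‖ := by
  simpa using hg.integrable_mul_norm_pow (by norm_num : 1 ≤ 3)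

lemma MemL1.integrable_mul_norm_sub (hg : MemL1 3 g) (v : V N) :
    Integrable fun w : V N => g w * ‖v - w‖ := by
  refine ((hg.integrable.norm.mul_const ‖v‖).add hg.integrable_mul_norm.norm).mono'
    (hg.integrable.aestronglyMeasurable.mul
      (by fun_prop : Continuous fun w : V N => ‖v - w‖).aestronglyMeasurable)
    (Eventually.of_forall fun w => ?_)
  simp only [Pi.add_apply, norm_mul, norm_norm]
  rw [← mul_add]
  gcongr
  exact norm_sub_le v w

/-- Linear upper bound for the convolution of `g` with `|·|`. -/
lemma integral_mul_norm_sub_le (hg0 : ∀ v, 0 ≤ g v) (hg : MemL1 3 g)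
    (hmass : (∫ v : V N, g v) = ρ) (v : V N) :
    (∫ w : V N, g w * ‖v - w‖) ≤ ρ * ‖v‖ + ∫ w : V N, g w * ‖w‖ := by
  have h0 := hg.integrable.mul_const ‖v‖
  rw [← hmass, ← integral_mul_const, ← integral_add h0 hg.integrable_mul_norm]
  refine integral_mono (hg.integrable_mul_norm_sub v) (h0.add hg.integrable_mul_norm) fun w => ?_
  simp only
  rw [← mul_add]
  exact mul_le_mul_of_nonneg_left (norm_sub_le v w) (hg0 w)

/-- Jensen-type lower bound, a consequence of vanishing momentum. -/
lemma mass_mul_norm_le_integral_mul_norm_sub (hg0 : ∀ v, 0 ≤ g v) (hg : MemL1 3 g)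
    (hmass : (∫ v : V N, g v) = ρ) (hmom : (∫ v : V N, g v • v) = 0) (hρ : 0 ≤ ρ) (v : V N) :
    ρ * ‖v‖ ≤ ∫ w : V N, g w * ‖v - w‖ := by
  have hv : Integrable fun w : V N => g w • w :=
    hg.integrable_mul_norm.mono
      (hg.integrable.aestronglyMeasurable.smul continuous_id.aestronglyMeasurable)
      (Eventually.of_forall fun w => by simp [norm_smul])
  have hid : (∫ w : V N, g w • (v - w)) = ρ • v := by
    simp_rw [smul_sub]
    rw [integral_sub (hg.integrable.smul_const v) hv, integral_smul_const, hmom, hmass, sub_zero]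
  calc ρ * ‖v‖ = ‖∫ w : V N, g w • (v - w)‖ := by
        rw [hid, norm_smul, Real.norm_of_nonneg hρ]
    _ ≤ ∫ w : V N, ‖g w • (v - w)‖ := norm_integral_le_integral_norm _
    _ = ∫ w : V N, g w * ‖v - w‖ := by
        simp_rw [norm_smul, Real.norm_of_nonneg (hg0 _)]

/-- Translating the centre of the first moment costs at most `ρ|v|`. -/
lemma first_moment_le (hg0 : ∀ v, 0 ≤ g v) (hg : MemL1 3 g)
    (hmass : (∫ v : V N, g v) = ρ) (v : V N) :
    (∫ w : V N, g w * ‖w‖) ≤ (∫ w : V N, g w * ‖v - w‖) + ρ * ‖v‖ := by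
  have h0 := hg.integrable.mul_const ‖v‖
  rw [← hmass, ← integral_mul_const, ← integral_add (hg.integrable_mul_norm_sub v) h0]
  refine integral_mono hg.integrable_mul_norm ((hg.integrable_mul_norm_sub v).add h0) fun w => ?_
  simp only
  rw [← mul_add]
  refine mul_le_mul_of_nonneg_left ?_ (hg0 w)
  linarith [norm_sub_norm_le w v, norm_sub_rev v w]

/-- The first moment is controlled by the mass and the third moment. -/
lemma first_moment_le_mass_add (hg0 : ∀ v, 0 ≤ g v) (hg : MemL1 3 g)
    (hmass : (∫ v : V N, g v) = ρ) :
    (∫ w : V N, g w * ‖w‖) ≤ ρ + ∫ w : V N, g w * ‖w‖ ^ 3 := by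
  have h3 := hg.integrable_mul_norm_pow le_rfl
  rw [← hmass, ← integral_add hg.integrable h3]
  refine integral_mono hg.integrable_mul_norm (hg.integrable.add h3) fun w => ?_
  have hx := norm_nonneg w
  have key : ‖w‖ ≤ 1 + ‖w‖ ^ 3 := by
    nlinarith [mul_nonneg hx (sq_nonneg (‖w‖ - 1)), sq_nonneg (‖w‖ - 1)]
  calc g w * ‖w‖ ≤ g w * (1 + ‖w‖ ^ 3) := mul_le_mul_of_nonneg_left key (hg0 w)
    _ = g w + g w * ‖w‖ ^ 3 := by ring

/-- The energy is interpolated between the first and third moments. -/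
lemma energy_le_interpolation (hg0 : ∀ v, 0 ≤ g v) (hg : MemL1 3 g) {R : ℝ} (hR : 0 < R) :
    (∫ w : V N, g w * ‖w‖ ^ 2) ≤
      R * (∫ w : V N, g w * ‖w‖) + R⁻¹ * ∫ w : V N, g w * ‖w‖ ^ 3 := by
  have h1 := hg.integrable_mul_norm.const_mul R
  have h3 := (hg.integrable_mul_norm_pow le_rfl).const_mul R⁻¹
  rw [← integral_const_mul, ← integral_const_mul, ← integral_add h1 h3]
  refine integral_mono (hg.integrable_mul_norm_pow (by norm_num : 2 ≤ 3)) (h1.add h3) fun w => ?_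
  have hx := norm_nonneg w
  have key : ‖w‖ ^ 2 ≤ R * ‖w‖ + R⁻¹ * ‖w‖ ^ 3 := by
    have hsq : R * ‖w‖ + R⁻¹ * ‖w‖ ^ 3 - ‖w‖ ^ 2 =
        R⁻¹ * ‖w‖ * ((R - ‖w‖) ^ 2 + R * ‖w‖) := by
      field_simp
      ring
    have : 0 ≤ R⁻¹ * ‖w‖ * ((R - ‖w‖) ^ 2 + R * ‖w‖) := by positivity
    linarith
  calc g w * ‖w‖ ^ 2 ≤ g w * (R * ‖w‖ + R⁻¹ * ‖w‖ ^ 3) :=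
        mul_le_mul_of_nonneg_left key (hg0 w)
    _ = R * (g w * ‖w‖) + R⁻¹ * (g w * ‖w‖ ^ 3) := by ring

end Moments

/-- Quantitative two-sided bounds for `L(g)` under energy and third-moment bounds. -/
lemma Lconv_bounds_of_moments {N : ℕ} (hN : 2 ≤ N) {b : ℝ → ℝ} (hb : CrossSection b)
    {e : V N} (he : ‖e‖ = 1) {a₁ a₂ : ℝ} (ha₁ : 0 < a₁) (ha₂ : 0 < a₂) :
    ∃ C : ℝ, 0 < C ∧ ∀ g : V N → ℝ, ∀ ρ : ℝ, (∀ v, 0 ≤ g v) → MemL1 3 g → 0 < ρ →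
      (∫ v : V N, g v) = ρ → (∫ v : V N, g v • v) = 0 →
      a₁ * ρ ≤ (∫ v : V N, g v * ‖v‖ ^ 2) →
      (∫ v : V N, g v * ‖v‖ ^ 3) ≤ a₂ * ρ →
      ∀ v : V N, C⁻¹ * ρ * (1 + ‖v‖) ≤ Lconv b e g v ∧ Lconv b e g v ≤ C * ρ * (1 + ‖v‖) := by
  have hB := hb.b0_pos hN he
  set B := b0 N b e
  set κ := min 1 (a₁ ^ 2 / (4 * a₂))
  have hκ0 : 0 < κ := lt_min one_pos (by positivity)
  have hc : 0 < B * κ / 3 := by positivity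
  refine ⟨(B * κ / 3)⁻¹ + B * (1 + a₂), by positivity, ?_⟩
  intro g ρ hg0 hg hρ hmass hmom h2 h3 v
  have hJ := mass_mul_norm_le_integral_mul_norm_sub hg0 hg hmass hmom hρ.le v
  have hU := integral_mul_norm_sub_le hg0 hg hmass v
  have hT := first_moment_le hg0 hg hmass v
  have hM := first_moment_le_mass_add hg0 hg hmass
  have hI := energy_le_interpolation hg0 hg (R := 2 * a₂ / a₁) (by positivity)
  have hL : Lconv b e g v = B * ∫ w : V N, g w * ‖v - w‖ := rfl
  rw [hL]
  set I := ∫ w : V N, g w * ‖v - w‖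
  set m₁ := ∫ w : V N, g w * ‖w‖
  have hm : a₁ ^ 2 / (4 * a₂) * ρ ≤ m₁ := by
    have h3' := mul_le_mul_of_nonneg_left h3 (by positivity : 0 ≤ (2 * a₂ / a₁)⁻¹)
    have he1 : (2 * a₂ / a₁)⁻¹ * (a₂ * ρ) = a₁ * ρ / 2 := by field_simp
    have h4 : a₁ * ρ / 2 ≤ 2 * a₂ / a₁ * m₁ := by linarith
    calc a₁ ^ 2 / (4 * a₂) * ρ = (2 * a₂ / a₁)⁻¹ * (a₁ * ρ / 2) := by field_simp; ring
      _ ≤ (2 * a₂ / a₁)⁻¹ * (2 * a₂ / a₁ * m₁) := by gcongr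
      _ = m₁ := by field_simp
  have hlow : κ / 3 * ρ * (1 + ‖v‖) ≤ I := by
    have h5 : κ * ρ ≤ m₁ := (mul_le_mul_of_nonneg_right (min_le_right _ _) hρ.le).trans hm
    have h6 : κ * (ρ * ‖v‖) ≤ ρ * ‖v‖ :=
      mul_le_of_le_one_left (by positivity) (min_le_left _ _)
    linarith
  have hup : I ≤ (1 + a₂) * ρ * (1 + ‖v‖) := by
    have : 0 ≤ a₂ * ρ * ‖v‖ := by positivity
    linarith
  have hv : 0 ≤ ρ * (1 + ‖v‖) := by positivity
  constructor
  · have hCinv : ((B * κ / 3)⁻¹ + B * (1 + a₂))⁻¹ ≤ B * κ / 3 :=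
      inv_le_of_inv_le₀ hc (le_add_of_nonneg_right (by positivity))
    calc ((B * κ / 3)⁻¹ + B * (1 + a₂))⁻¹ * ρ * (1 + ‖v‖)
        = ((B * κ / 3)⁻¹ + B * (1 + a₂))⁻¹ * (ρ * (1 + ‖v‖)) := by ring
      _ ≤ B * κ / 3 * (ρ * (1 + ‖v‖)) := mul_le_mul_of_nonneg_right hCinv hv
      _ = B * (κ / 3 * ρ * (1 + ‖v‖)) := by ring
      _ ≤ B * I := mul_le_mul_of_nonneg_left hlow hB.le
  · calc B * I ≤ B * ((1 + a₂) * ρ * (1 + ‖v‖)) := mul_le_mul_of_nonneg_left hup hB.le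
      _ = B * (1 + a₂) * (ρ * (1 + ‖v‖)) := by ring
      _ ≤ ((B * κ / 3)⁻¹ + B * (1 + a₂)) * (ρ * (1 + ‖v‖)) :=
        mul_le_mul_of_nonneg_right (le_add_of_nonneg_left (by positivity)) hv
      _ = _ := by ring

/-- Two-sided linear-growth bounds for the loss convolution operator:
(i) for any nonnegative `g ∈ L¹₃` of positive mass and zero momentum,
`c₁(1+|v|) ≤ L(g)(v) ≤ c₂(1+|v|)`; (ii) under the normalized energy lower bound and
third-moment upper bound, one can take `c₁ = ρ/C`, `c₂ = Cρ` with `C` depending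
only on `a₁, a₂` (and `b₀`). -/
theorem loss_operator_bounds
    (N : ℕ) (hN : 2 ≤ N) (b : ℝ → ℝ) (hb : CrossSection b)
    (e : V N) (he : ‖e‖ = 1) :
    (∀ g : V N → ℝ, ∀ ρ : ℝ, (∀ v, 0 ≤ g v) → MemL1 3 g → 0 < ρ →
      (∫ v : V N, g v) = ρ → (∫ v : V N, g v • v) = 0 →
      ∃ c₁ c₂ : ℝ, 0 < c₁ ∧ 0 < c₂ ∧ ∀ v : V N,
        c₁ * (1 + ‖v‖) ≤ Lconv b e g v ∧ Lconv b e g v ≤ c₂ * (1 + ‖v‖)) ∧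
    (∀ a₁ a₂ : ℝ, 0 < a₁ → 0 < a₂ → ∃ C : ℝ, 0 < C ∧
      ∀ g : V N → ℝ, ∀ ρ : ℝ, (∀ v, 0 ≤ g v) → MemL1 3 g → 0 < ρ →
        (∫ v : V N, g v) = ρ → (∫ v : V N, g v • v) = 0 →
        a₁ * ρ ≤ (∫ v : V N, g v * ‖v‖ ^ 2) →
        (∫ v : V N, g v * ‖v‖ ^ 3) ≤ a₂ * ρ →
        ∀ v : V N,
          C⁻¹ * ρ * (1 + ‖v‖) ≤ Lconv b e g v ∧
          Lconv b e g v ≤ C * ρ * (1 + ‖v‖)) := by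
  refine ⟨fun g ρ hg0 hg hρ hmass hmom => ?_,
    fun a₁ a₂ ha₁ ha₂ => Lconv_bounds_of_moments hN hb he ha₁ ha₂⟩
  have hE := energy_pos hN hg0 hg (hmass ▸ hρ)
  have hm₃ : 0 ≤ ∫ v : V N, g v * ‖v‖ ^ 3 :=
    integral_nonneg fun v => mul_nonneg (hg0 v) (by positivity)
  obtain ⟨C, hC, h⟩ := Lconv_bounds_of_moments hN hb he (div_pos hE hρ)
    (by positivity : 0 < (∫ v : V N, g v * ‖v‖ ^ 3) / ρ + 1)
  refine ⟨C⁻¹ * ρ, C * ρ, by positivity, by positivity,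
    h g ρ hg0 hg hρ hmass hmom (div_mul_cancel₀ _ hρ.ne').le ?_⟩
  rw [add_mul, div_mul_cancel₀ _ hρ.ne']
  linarith
end
end

section
/- Kinetic energy contraction outside grazing directions and stability of stretched-exponential weights: let N ≥ 2, α ∈ (0,1], v, v_* ∈ ℝ^N with w = v + v_* ≠ 0, σ ∈ S^{N−1}, and define χ ∈ [0,π/2] by cos χ = |σ·(w/|w|)|. Let v' = (v+v_*)/2 + ((1−α)/4)(v−v_*) + ((1+α)/4)|v−v_*|σ and v'_* = (v+v_*)/2 − ((1−α)/4)(v−v_*) − ((1+α)/4)|v−v_*|σ. Then: (a) |v'|² ≤ |v|² + |v_*|² − ((1+α)/8) sin²χ |v+v_*|² and |v'_*|² ≤ |v|² + |v_*|² − ((1+α)/8) sin²χ |v+v_*|²; (b) for any s ∈ (0,1), a > 0 and δ ∈ (0,1), if sin²χ ≥ δ then e^{a|v'|^s} ≤ e^{k a|v|^s} e^{k a|v_*|^s} with k = (1 − δ/160)^{s/2}. -/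
open MeasureTheory Real Filter Set
open scoped InnerProductSpace ENNReal

noncomputable section

section InnerProduct

variable {E : Type*} [NormedAddCommGroup E] [InnerProductSpace ℝ E]

/-- The squared norm of a convex combination is at most the convex combination of the squared
norms. -/
theorem norm_sq_convex_comb_le {t : ℝ} (ht0 : 0 ≤ t) (ht1 : t ≤ 1) (x y : E) :
    ‖(1 - t) • x + t • y‖ ^ 2 ≤ (1 - t) * ‖x‖ ^ 2 + t * ‖y‖ ^ 2 := by
  have h : ‖(1 - t) • x + t • y‖ ^ 2 =
      (1 - t) * ‖x‖ ^ 2 + t * ‖y‖ ^ 2 - t * (1 - t) * ‖x - y‖ ^ 2 := by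
    rw [norm_add_sq_real, norm_sub_sq_real, norm_smul, norm_smul, mul_pow, mul_pow,
      Real.norm_eq_abs, Real.norm_eq_abs, sq_abs, sq_abs, real_inner_smul_left,
      real_inner_smul_right]
    ring
  have := mul_nonneg (mul_nonneg ht0 (sub_nonneg.2 ht1)) (sq_nonneg ‖x - y‖)
  linarith

/-- Energy bound for a post-collisional velocity, in terms of the total velocity `w`, the relative
velocity `u` and the scattering direction `e`. -/
theorem norm_sq_collision_le {α : ℝ} (hα : α ∈ Set.Ioc (0 : ℝ) 1) {w : E} (hw : w ≠ 0) (u : E)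
    {e : E} (he : ‖e‖ = 1) :
    ‖(2 : ℝ)⁻¹ • w + ((1 - α) / 4) • u + ((1 + α) / 4 * ‖u‖) • e‖ ^ 2 ≤
      (‖w‖ ^ 2 + ‖u‖ ^ 2) / 2 - (1 + α) / 8 * (1 - ⟪e, ‖w‖⁻¹ • w⟫_ℝ ^ 2) * ‖w‖ ^ 2 := by
  obtain ⟨h0, h1⟩ := hα
  have hdecomp : (2 : ℝ)⁻¹ • w + ((1 - α) / 4) • u + ((1 + α) / 4 * ‖u‖) • e =
      (1 - (1 + α) / 2) • ((2 : ℝ)⁻¹ • (w + u)) +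
        ((1 + α) / 2) • ((2 : ℝ)⁻¹ • (w + ‖u‖ • e)) := by
    module
  have hhalf (x : E) : ‖(2 : ℝ)⁻¹ • x‖ ^ 2 = ‖x‖ ^ 2 / 4 := by
    rw [norm_smul, mul_pow, Real.norm_eq_abs, sq_abs]
    ring
  have hwn : ‖w‖ ≠ 0 := norm_ne_zero_iff.2 hw
  have hx : ‖(2 : ℝ)⁻¹ • (w + u)‖ ^ 2 ≤ (‖w‖ ^ 2 + ‖u‖ ^ 2) / 2 := by
    have := parallelogram_law_with_norm ℝ w u
    rw [hhalf]
    nlinarith [sq_nonneg ‖w - u‖]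
  have hy : ‖(2 : ℝ)⁻¹ • (w + ‖u‖ • e)‖ ^ 2 ≤
      (‖w‖ ^ 2 + ‖u‖ ^ 2) / 2 - (1 - ⟪e, ‖w‖⁻¹ • w⟫_ℝ ^ 2) * ‖w‖ ^ 2 / 4 := by
    have hc : ⟪w, e⟫_ℝ = ⟪e, ‖w‖⁻¹ • w⟫_ℝ * ‖w‖ := by
      rw [real_inner_smul_right, real_inner_comm]
      field_simp
    rw [hhalf, norm_add_sq_real, real_inner_smul_right, hc, norm_smul, he, norm_norm]
    nlinarith [sq_nonneg (‖u‖ - ⟪e, ‖w‖⁻¹ • w⟫_ℝ * ‖w‖)]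
  rw [hdecomp]
  calc _ ≤ _ := norm_sq_convex_comb_le (by linarith) (by linarith) _ _
    _ ≤ (1 - (1 + α) / 2) * ((‖w‖ ^ 2 + ‖u‖ ^ 2) / 2) + (1 + α) / 2 *
        ((‖w‖ ^ 2 + ‖u‖ ^ 2) / 2 - (1 - ⟪e, ‖w‖⁻¹ • w⟫_ℝ ^ 2) * ‖w‖ ^ 2 / 4) :=
      add_le_add (mul_le_mul_of_nonneg_left hx (by linarith))
        (mul_le_mul_of_nonneg_left hy (by linarith))
    _ = _ := by ring

theorem norm_collision_le {α : ℝ} (hα : α ∈ Set.Ioc (0 : ℝ) 1) (w u : E) {e : E} (he : ‖e‖ = 1) :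
    ‖(2 : ℝ)⁻¹ • w + ((1 - α) / 4) • u + ((1 + α) / 4 * ‖u‖) • e‖ ≤ (‖w‖ + ‖u‖) / 2 := by
  obtain ⟨h0, h1⟩ := hα
  refine norm_add₃_le.trans (le_of_eq ?_)
  rw [norm_smul, norm_smul, norm_smul, he, Real.norm_of_nonneg (by norm_num),
    Real.norm_of_nonneg (by linarith), Real.norm_of_nonneg (by positivity)]
  ring

/-- Outside grazing directions a post-collisional velocity carries at most a fixed fraction of the
kinetic energy. -/
theorem norm_sq_collision_le_mul {α δ : ℝ} (hα : α ∈ Set.Ioc (0 : ℝ) 1) {w : E} (hw : w ≠ 0)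
    (u : E) {e : E} (he : ‖e‖ = 1) (hδ : δ ∈ Set.Ioo (0 : ℝ) 1)
    (h : δ ≤ 1 - ⟪e, ‖w‖⁻¹ • w⟫_ℝ ^ 2) :
    ‖(2 : ℝ)⁻¹ • w + ((1 - α) / 4) • u + ((1 + α) / 4 * ‖u‖) • e‖ ^ 2 ≤
      (1 - δ / 160) * ((‖w‖ ^ 2 + ‖u‖ ^ 2) / 2) := by
  have hE : 0 ≤ (‖w‖ ^ 2 + ‖u‖ ^ 2) / 2 := by positivity
  rcases le_total (2 * ‖w‖) ‖u‖ with hwu | hwu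
  · have hsq := pow_le_pow_left₀ (norm_nonneg _) (norm_collision_le hα w u he) 2
    have hgap : (‖u‖ / 2) ^ 2 ≤ (‖u‖ - ‖w‖) ^ 2 :=
      pow_le_pow_left₀ (by positivity) (by linarith) 2
    have hw2 : (2 * ‖w‖) ^ 2 ≤ ‖u‖ ^ 2 := pow_le_pow_left₀ (by positivity) hwu 2
    have := mul_le_mul_of_nonneg_right hδ.2.le hE
    nlinarith
  · have hu2 : ‖u‖ ^ 2 ≤ (2 * ‖w‖) ^ 2 := pow_le_pow_left₀ (norm_nonneg _) hwu 2
    have hgain : 1 / 8 * δ * ‖w‖ ^ 2 ≤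
        (1 + α) / 8 * (1 - ⟪e, ‖w‖⁻¹ • w⟫_ℝ ^ 2) * ‖w‖ ^ 2 := by
      have h0 := hδ.1
      have h1 := hα.1
      gcongr
      linarith
    have := mul_le_mul_of_nonneg_left hu2 hδ.1.le
    have := mul_nonneg hδ.1.le (sq_nonneg ‖w‖)
    linarith [norm_sq_collision_le hα hw u he]

end InnerProduct

/-- If `x² ≤ c (y² + z²)`, then `x ^ s ≤ c ^ (s / 2) (y ^ s + z ^ s)` for `s ∈ [0, 2]`. -/
theorem rpow_le_of_sq_le_mul_add_sq {x y z c s : ℝ} (hx : 0 ≤ x) (hy : 0 ≤ y) (hz : 0 ≤ z)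
    (hc : 0 ≤ c) (hs0 : 0 ≤ s) (hs2 : s ≤ 2) (h : x ^ 2 ≤ c * (y ^ 2 + z ^ 2)) :
    x ^ s ≤ c ^ (s / 2) * (y ^ s + z ^ s) := by
  have hpow {t : ℝ} (ht : 0 ≤ t) : (t ^ 2) ^ (s / 2) = t ^ s := by
    rw [← Real.rpow_natCast_mul ht]
    congr 1
    push_cast
    ring
  calc x ^ s = (x ^ 2) ^ (s / 2) := (hpow hx).symm
    _ ≤ (c * (y ^ 2 + z ^ 2)) ^ (s / 2) := by gcongr
    _ = c ^ (s / 2) * (y ^ 2 + z ^ 2) ^ (s / 2) := Real.mul_rpow hc (by positivity)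
    _ ≤ c ^ (s / 2) * ((y ^ 2) ^ (s / 2) + (z ^ 2) ^ (s / 2)) := by
      gcongr
      exact Real.rpow_add_le_add_rpow (sq_nonneg y) (sq_nonneg z) (by linarith) (by linarith)
    _ = c ^ (s / 2) * (y ^ s + z ^ s) := by rw [hpow hy, hpow hz]

/-- (a) Kinetic energy contraction:
`|v'|², |v'_*|² ≤ |v|²+|v_*|² - ((1+α)/8) sin²χ |v+v_*|²` where
`sin²χ = 1 - (σ·ŵ)²`, `w = v+v_*`; (b) stability of stretched-exponential weights
outside grazing directions: if `sin²χ ≥ δ` then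
`e^{a|v'|^s} ≤ e^{ka|v|^s} e^{ka|v_*|^s}` with `k = (1-δ/160)^{s/2}`. -/
theorem energy_contraction_and_weight_stability
    (N : ℕ) (hN : 2 ≤ N) (α : ℝ) (hα : α ∈ Set.Ioc (0:ℝ) 1)
    (v vs : V N) (hw : v + vs ≠ 0) (σ : Sph N) :
    (‖postV α v vs σ‖ ^ 2 ≤ ‖v‖ ^ 2 + ‖vs‖ ^ 2 -
        (1 + α) / 8 * (1 - ⟪(σ : V N), ‖v + vs‖⁻¹ • (v + vs)⟫_ℝ ^ 2) * ‖v + vs‖ ^ 2 ∧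
      ‖postVs α v vs σ‖ ^ 2 ≤ ‖v‖ ^ 2 + ‖vs‖ ^ 2 -
        (1 + α) / 8 * (1 - ⟪(σ : V N), ‖v + vs‖⁻¹ • (v + vs)⟫_ℝ ^ 2) * ‖v + vs‖ ^ 2) ∧
    ∀ s a δ : ℝ, s ∈ Set.Ioo (0:ℝ) 1 → 0 < a → δ ∈ Set.Ioo (0:ℝ) 1 →
      δ ≤ 1 - ⟪(σ : V N), ‖v + vs‖⁻¹ • (v + vs)⟫_ℝ ^ 2 →
      Real.exp (a * ‖postV α v vs σ‖ ^ s) ≤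
        Real.exp ((1 - δ / 160) ^ (s / 2) * a * ‖v‖ ^ s) *
          Real.exp ((1 - δ / 160) ^ (s / 2) * a * ‖vs‖ ^ s) := by
  have he : ‖(σ : V N)‖ = 1 := norm_eq_of_mem_sphere σ
  have hE : ‖v‖ ^ 2 + ‖vs‖ ^ 2 = (‖v + vs‖ ^ 2 + ‖v - vs‖ ^ 2) / 2 := by
    have := parallelogram_law_with_norm ℝ v vs
    linarith
  refine ⟨⟨?_, ?_⟩, fun s a δ hs ha hδ h => ?_⟩
  · rw [hE]
    exact norm_sq_collision_le hα hw (v - vs) he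
  · have := norm_sq_collision_le hα hw (-(v - vs)) ((norm_neg (σ : V N)).trans he)
    rwa [norm_neg, smul_neg, smul_neg, ← sub_eq_add_neg, ← sub_eq_add_neg, inner_neg_left, neg_sq,
      ← hE] at this
  · have hsq : ‖postV α v vs σ‖ ^ 2 ≤ (1 - δ / 160) * (‖v‖ ^ 2 + ‖vs‖ ^ 2) := by
      rw [hE]
      exact norm_sq_collision_le_mul hα hw (v - vs) he hδ h
    have hpow := rpow_le_of_sq_le_mul_add_sq (norm_nonneg _) (norm_nonneg v) (norm_nonneg vs)
      (by linarith [hδ.2]) hs.1.le (by linarith [hs.2]) hsq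
    rw [← Real.exp_add, Real.exp_le_exp]
    linarith [mul_le_mul_of_nonneg_left hpow ha.le]
end
end

section
/- Gronwall-type lemma with superlinear error term: let μ, a, b, θ ∈ (0,∞) and X ≥ 0, and let y : [0,∞) → [0,∞) be continuous and satisfy y(t) ≤ a e^{−μt} X + b ∫₀^t e^{−μ(t−s)} y(s)^{1+θ} ds for all t ≥ 0. Then there exist constants ε₀ > 0 and C > 0, depending only on a, θ and μ, such that if X ≤ ε₀ and b ≤ ε₀ then y(t) ≤ C X e^{−μt} for all t ≥ 0. -/
open MeasureTheory Real Filter Set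

noncomputable section

/-- A continuous function on `[0, ∞)` that starts below `K`, and stays below `K` at `t` as soon as it
does so before `t`, is below `K` everywhere. -/
theorem lt_of_continuousOn_bootstrap {z : ℝ → ℝ} {K : ℝ} (hz : ContinuousOn z (Set.Ici 0))
    (hstep : ∀ t, 0 ≤ t → (∀ s, 0 ≤ s → s < t → z s < K) → z t < K) :
    ∀ t, 0 ≤ t → z t < K := by
  by_contra! ⟨t, ht, hKt⟩
  let S : Set ℝ := Set.Ici 0 ∩ z ⁻¹' Set.Ici K
  have hS : IsClosed S := hz.preimage_isClosed_of_isClosed isClosed_Ici isClosed_Ici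
  have hbdd : BddBelow S := ⟨0, fun s hs => hs.1⟩
  obtain ⟨h0, hK⟩ : sInf S ∈ S := hS.csInf_mem ⟨t, ht, hKt⟩ hbdd
  refine absurd (hstep _ h0 fun s hs hlt => ?_) (not_lt.mpr hK)
  by_contra! h
  exact absurd (csInf_le hbdd ⟨hs, h⟩) (not_le.mpr hlt)

theorem integral_exp_neg_mul_le {c : ℝ} (hc : 0 < c) (t : ℝ) :
    ∫ s in (0:ℝ)..t, Real.exp (-c * s) ≤ 1 / c := by
  have hderiv : ∀ s ∈ Set.uIcc 0 t,
      HasDerivAt (fun s => -Real.exp (-c * s) / c) (Real.exp (-c * s)) s := by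
    intro s _
    have h := ((hasDerivAt_id' s).const_mul (-c)).exp.fun_neg.div_const c
    refine h.congr_deriv ?_
    field_simp
  rw [intervalIntegral.integral_eq_sub_of_hasDerivAt hderiv
    (Continuous.intervalIntegrable (by fun_prop) _ _)]
  have := Real.exp_pos (-c * t)
  rw [← sub_div]
  gcongr
  simp only [mul_zero, Real.exp_zero]
  linarith

/-- Exponential decay of `y` at rate `μ` is preserved, with a superlinear constant, by the integral
term of the Gronwall inequality. -/
theorem integral_exp_mul_rpow_le {μ θ K t : ℝ} (hμ : 0 < μ) (hθ : 0 < θ) (hK : 0 ≤ K)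
    (ht : 0 ≤ t) {y : ℝ → ℝ} (hy : ContinuousOn y (Set.Ici 0)) (hy0 : ∀ s, 0 ≤ s → 0 ≤ y s)
    (hyK : ∀ s, 0 ≤ s → s < t → y s ≤ K * Real.exp (-μ * s)) :
    ∫ s in (0:ℝ)..t, Real.exp (-μ * (t - s)) * y s ^ (1 + θ) ≤
      K ^ (1 + θ) * Real.exp (-μ * t) * (1 / (μ * θ)) := by
  calc ∫ s in (0:ℝ)..t, Real.exp (-μ * (t - s)) * y s ^ (1 + θ)
      ≤ ∫ s in (0:ℝ)..t, K ^ (1 + θ) * Real.exp (-μ * t) * Real.exp (-(μ * θ) * s) := by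
        refine intervalIntegral.integral_mono_on_of_le_Ioo ht ?_
          (Continuous.intervalIntegrable (by fun_prop) _ _) fun s hs => ?_
        · refine ContinuousOn.intervalIntegrable ?_
          rw [Set.uIcc_of_le ht]
          refine ContinuousOn.mul (by fun_prop) ?_
          exact (hy.mono Set.Icc_subset_Ici_self).rpow_const fun s _ => Or.inr (by positivity)
        · calc Real.exp (-μ * (t - s)) * y s ^ (1 + θ)
              ≤ Real.exp (-μ * (t - s)) * (K * Real.exp (-μ * s)) ^ (1 + θ) := by
                gcongr
                · exact hy0 s hs.1.le
                · exact hyK s hs.1.le hs.2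
            _ = K ^ (1 + θ) * (Real.exp (-μ * (t - s)) * Real.exp (-μ * s * (1 + θ))) := by
                rw [Real.mul_rpow hK (Real.exp_pos _).le, ← Real.exp_mul]
                ring
            _ = K ^ (1 + θ) * Real.exp (-μ * t) * Real.exp (-(μ * θ) * s) := by
                rw [mul_assoc (K ^ (1 + θ)), ← Real.exp_add, ← Real.exp_add]
                ring_nf
    _ ≤ K ^ (1 + θ) * Real.exp (-μ * t) * (1 / (μ * θ)) := by
        rw [intervalIntegral.integral_const_mul]
        gcongr
        exact integral_exp_neg_mul_le (mul_pos hμ hθ) t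

/-- The superlinear Gronwall bound for positive `X`, under an explicit smallness condition. -/
theorem gronwall_superlinear_of_pos {μ a θ b X : ℝ} (hμ : 0 < μ) (ha : 0 < a) (hθ : 0 < θ)
    (hb : 0 < b) (hX : 0 < X) {y : ℝ → ℝ} (hy : ContinuousOn y (Set.Ici 0))
    (hy0 : ∀ t, 0 ≤ t → 0 ≤ y t)
    (hineq : ∀ t, 0 ≤ t → y t ≤ a * Real.exp (-μ * t) * X +
      b * ∫ s in (0:ℝ)..t, Real.exp (-μ * (t - s)) * y s ^ (1 + θ))
    (hsmall : 2 * b * (2 * a * X) ^ θ < μ * θ) (t : ℝ) (ht : 0 ≤ t) :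
    y t ≤ 2 * a * X * Real.exp (-μ * t) := by
  have hlt_iff : ∀ s, Real.exp (μ * s) * y s < 2 * a * X ↔
      y s < 2 * a * X * Real.exp (-μ * s) := fun s => by
    rw [neg_mul, Real.exp_neg, ← div_eq_mul_inv, lt_div_iff₀ (Real.exp_pos _), mul_comm]
  refine ((hlt_iff t).mp (lt_of_continuousOn_bootstrap (z := fun s => Real.exp (μ * s) * y s)
    (ContinuousOn.mul (by fun_prop) hy) (fun r hr hlt => ?_) t ht)).le
  rw [hlt_iff]
  have hint := integral_exp_mul_rpow_le hμ hθ (K := 2 * a * X) (by positivity) hr hy hy0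
    fun s hs hsr => ((hlt_iff s).mp (hlt s hs hsr)).le
  have hpow : b * ((2 * a * X) ^ (1 + θ) * (1 / (μ * θ))) < a * X := by
    rw [Real.rpow_add (by positivity), Real.rpow_one]
    calc b * (2 * a * X * (2 * a * X) ^ θ * (1 / (μ * θ)))
        = a * X * (2 * b * (2 * a * X) ^ θ / (μ * θ)) := by ring
      _ < a * X * 1 := by
        gcongr
        rwa [div_lt_one (by positivity)]
      _ = a * X := mul_one _
  calc y r ≤ a * Real.exp (-μ * r) * X +
        b * ((2 * a * X) ^ (1 + θ) * Real.exp (-μ * r) * (1 / (μ * θ))) :=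
        (hineq r hr).trans (by gcongr)
    _ = (a * X + b * ((2 * a * X) ^ (1 + θ) * (1 / (μ * θ)))) * Real.exp (-μ * r) := by ring
    _ < (a * X + a * X) * Real.exp (-μ * r) := by gcongr
    _ = 2 * a * X * Real.exp (-μ * r) := by ring

/-- Gronwall-type lemma with a superlinear error term: if a nonnegative
continuous function `y` satisfies
`y(t) ≤ a e^{-μt} X + b ∫₀^t e^{-μ(t-s)} y(s)^{1+θ} ds`, then for `X` and `b` small
enough (with smallness threshold and final constant depending only on `a, θ, μ`),
`y(t) ≤ C X e^{-μt}` for all `t ≥ 0`. -/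
theorem gronwall_superlinear
    (μ a θ : ℝ) (hμ : 0 < μ) (ha : 0 < a) (hθ : 0 < θ) :
    ∃ ε₀ : ℝ, 0 < ε₀ ∧ ∃ C : ℝ, 0 < C ∧
      ∀ b X : ℝ, 0 < b → 0 ≤ X → ∀ y : ℝ → ℝ,
        ContinuousOn y (Set.Ici 0) →
        (∀ t, 0 ≤ t → 0 ≤ y t) →
        (∀ t, 0 ≤ t → y t ≤ a * Real.exp (-μ * t) * X +
          b * ∫ s in (0:ℝ)..t, Real.exp (-μ * (t - s)) * y s ^ (1 + θ)) →
        X ≤ ε₀ → b ≤ ε₀ →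
        ∀ t, 0 ≤ t → y t ≤ C * X * Real.exp (-μ * t) := by
  have hε : 0 < min 1 (μ * θ / (4 * (2 * a) ^ θ)) := by positivity
  refine ⟨_, hε, 2 * a, by positivity, ?_⟩
  intro b X hb hX y hy hy0 hineq hXε hbε t ht
  have hpos : ∀ Y, X ≤ Y → 0 < Y → Y ≤ min 1 (μ * θ / (4 * (2 * a) ^ θ)) →
      y t ≤ 2 * a * Y * Real.exp (-μ * t) := by
    intro Y hXY hY hYε
    refine gronwall_superlinear_of_pos hμ ha hθ hb hY hy hy0
      (fun r hr => (hineq r hr).trans (by gcongr)) ?_ t ht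
    have hY1 : Y ≤ 1 := hYε.trans (min_le_left _ _)
    have hb' := hbε.trans (min_le_right _ _)
    rw [le_div_iff₀ (by positivity)] at hb'
    have hpow : (2 * a * Y) ^ θ ≤ (2 * a) ^ θ := by
      refine Real.rpow_le_rpow (by positivity) ?_ hθ.le
      exact mul_le_of_le_one_right (by positivity) hY1
    have : 2 * b * (2 * a * Y) ^ θ ≤ 2 * b * (2 * a) ^ θ := by gcongr
    linarith [mul_pos hμ hθ]
  rcases hX.eq_or_lt with rfl | hX
  · have hlim : Tendsto (fun Y => 2 * a * Y * Real.exp (-μ * t)) (nhdsWithin 0 (Set.Ioi 0))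
        (nhds (2 * a * 0 * Real.exp (-μ * t))) :=
      (Continuous.tendsto (by fun_prop) 0).mono_left nhdsWithin_le_nhds
    refine ge_of_tendsto hlim ?_
    filter_upwards [Ioc_mem_nhdsGT hε] with Y hY using hpos Y hY.1.le hY.1 hY.2
  · exact hpos X le_rfl hX hXε
end
end
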